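/- Let r ≥ 2, let F be the free monoid on {1,…,r}, let d ≥ 2 be an integer, and let a_1,…,a_r be positive integers with gcd(a_1,…,a_r) = 1; set d_i = d^{a_i} and let ρ be the unique positive real with d_1^{−ρ}+⋯+d_r^{−ρ} = 1. Then there exists a positive constant C such that, as the real number X tends to infinity, #{ω ∈ F : |ω| ≤ X} / d^{ρ·⌊log_d X⌋} tends to C. -/

import Mathlib

open Filter

lemma aux_lower {r : ℕ} (a : Fin r → ℕ) (ha : ∀ i, 0 < a i) (p : Fin r → ℝ)
    (hp : ∀ i, 0 < p i) (hp1 : ∑ i, p i = 1) (A : ℕ) (hA : ∀ i, a i ≤ A) (w : ℕ → ℝ)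
    (hw : ∀ n, A ≤ n → w n = ∑ i, p i * w (n - a i)) (c : ℝ) (N : ℕ)
    (hc : ∀ n, N ≤ n → n < N + A → c ≤ w n) : ∀ n, N ≤ n → c ≤ w n := by
  intro n
  induction n using Nat.strong_induction_on with
  | _ n ih =>
    intro hn
    by_cases h : n < N + A
    · exact hc n hn h
    · rw [hw n (by omega)]
      calc c = ∑ i, p i * c := by rw [← Finset.sum_mul, hp1, one_mul]
        _ ≤ _ := by
          apply Finset.sum_le_sum
          intro i _
          have h1 := ha i
          have h2 := hA i
          exact mul_le_mul_of_nonneg_left (ih (n - a i) (by omega) (by omega)) (hp i).le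

lemma aux_conv {r : ℕ} (a : Fin r → ℕ) (ha : ∀ i, 0 < a i) (hgcd : Finset.univ.gcd a = 1)
    (p : Fin r → ℝ)
    (hp : ∀ i, 0 < p i) (hp1 : ∑ i, p i = 1) (A : ℕ) (hA : ∀ i, a i ≤ A) (w : ℕ → ℝ)
    (hw : ∀ n, A ≤ n → w n = ∑ i, p i * w (n - a i)) (hpos : ∀ n, 0 < w n) :
    ∃ C : ℝ, 0 < C ∧ Tendsto w atTop (nhds C) := by
  -- bounds
  obtain ⟨c, hc0, hc⟩ : ∃ c : ℝ, 0 < c ∧ ∀ n, c ≤ w n := by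
    have hne : (Finset.range (A + 1)).Nonempty := ⟨0, by simp⟩
    obtain ⟨m, hm, hmin⟩ := Finset.exists_min_image (Finset.range (A + 1)) w hne
    refine ⟨w m, hpos m, fun n => ?_⟩
    refine aux_lower a ha p hp hp1 A hA w hw (w m) 0 (fun n _ hn => hmin n ?_) n (Nat.zero_le _)
    simp; omega
  obtain ⟨B, hB⟩ : ∃ B : ℝ, ∀ n, w n ≤ B := by
    have hne : (Finset.range (A + 1)).Nonempty := ⟨0, by simp⟩
    obtain ⟨m, hm, hmax⟩ := Finset.exists_max_image (Finset.range (A + 1)) w hne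
    refine ⟨w m, fun n => ?_⟩
    have := aux_lower a ha p hp hp1 A hA (fun n => - w n)
      (fun n hn => by simp [hw n hn]) (-w m) 0
      (fun n _ hn => neg_le_neg (hmax n (by simp; omega))) n (Nat.zero_le _)
    exact neg_le_neg_iff.mp this
  set L := limsup w atTop with hL
  have hbdd : IsBoundedUnder (· ≤ ·) atTop w := isBoundedUnder_of ⟨B, hB⟩
  have hbdd' : IsBoundedUnder (· ≥ ·) atTop w := isBoundedUnder_of ⟨c, hc⟩
  have hup : ∀ ε > 0, ∀ᶠ n in atTop, w n < L + ε := fun ε hε =>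
    eventually_lt_of_limsup_lt (by linarith) hbdd
  have hfreq : ∀ ε > 0, ∃ᶠ n in atTop, L - ε < w n := fun ε hε =>
    frequently_lt_of_lt_limsup hbdd'.isCoboundedUnder_le (by linarith)
  have hcl : MapClusterPt L atTop w := by
    rw [mapClusterPt_iff_frequently]
    intro s hs
    obtain ⟨ε, hε, hs⟩ := Metric.mem_nhds_iff.mp hs
    refine ((hfreq ε hε).and_eventually (hup ε hε)).mono fun n hn => hs ?_
    rw [Metric.mem_ball, Real.dist_eq, abs_lt]
    constructor <;> linarith [hn.1, hn.2]
  obtain ⟨U, hU, hUL⟩ := mapClusterPt_iff_ultrafilter.mp hcl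
  have hlim : ∀ s : ℕ, ∃ l : ℝ, Tendsto (fun n => w (n - s)) U (nhds l) := by
    intro s
    obtain ⟨l, _, hl⟩ := (isCompact_Icc (a := c) (b := B)).ultrafilter_le_nhds
      (U.map (fun n => w (n - s))) (by
        rw [le_principal_iff]
        exact Filter.mem_map.mpr (Filter.univ_mem' fun n => ⟨hc _, hB _⟩))
    exact ⟨l, hl⟩
  choose l hl using hlim
  have hlL : ∀ s, l s ≤ L := by
    intro s
    refine le_of_forall_pos_le_add fun ε hε => ?_
    have h1 : ∀ᶠ n in atTop, w (n - s) < L + ε := (tendsto_sub_atTop_nat s).eventually (hup ε hε)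
    have h2 : ∀ᶠ n in (U : Filter ℕ), w (n - s) < L + ε := hU h1
    exact le_of_tendsto (hl s) (h2.mono fun n hn => hn.le)
  have hl0 : l 0 = L := tendsto_nhds_unique (hl 0) (by simpa using hUL)
  have hrec : ∀ s, l s = ∑ i, p i * l (s + a i) := by
    intro s
    refine tendsto_nhds_unique (hl s) ?_
    have h1 : Tendsto (fun n => ∑ i, p i * w (n - (s + a i))) U
        (nhds (∑ i, p i * l (s + a i))) :=
      tendsto_finsetSum _ fun i _ => (hl (s + a i)).const_mul (p i)
    refine h1.congr' ?_
    have h2 : ∀ᶠ n in (U : Filter ℕ), A + s ≤ n := hU (eventually_ge_atTop (A + s))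
    filter_upwards [h2] with n hn
    rw [hw (n - s) (by omega)]
    simp only [Nat.sub_sub]
  have hstep : ∀ s, l s = L → ∀ i, l (s + a i) = L := by
    intro s hs i
    have h0 : ∑ j, p j * (L - l (s + a j)) = 0 := by
      simp only [mul_sub, Finset.sum_sub_distrib]
      rw [← hrec, ← Finset.sum_mul, hp1, hs]; ring
    have h1 := (Finset.sum_eq_zero_iff_of_nonneg (fun j _ =>
      mul_nonneg (hp j).le (sub_nonneg.mpr (hlL (s + a j))))).mp h0 i (Finset.mem_univ i)
    rcases mul_eq_zero.mp h1 with h | h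
    · exact absurd h (hp i).ne'
    · linarith
  have hclos : ∀ t ∈ AddSubmonoid.closure (Set.range a), ∀ s, l s = L → l (s + t) = L := by
    intro t ht
    induction ht using AddSubmonoid.closure_induction with
    | mem x hx => obtain ⟨i, rfl⟩ := hx; exact fun s hs => hstep s hs i
    | zero => exact fun s hs => hs
    | add x y _ _ hx hy =>
      intro s hs
      rw [← add_assoc]
      exact hy _ (hx s hs)
  obtain ⟨N, hN⟩ := Nat.exists_mem_closure_of_ge (Set.range a)
  have hg : Nat.setGcd (Set.range a) = 1 := by
    rw [← Nat.dvd_one, ← hgcd]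
    exact Finset.dvd_gcd fun i _ => Nat.setGcd_dvd_of_mem ⟨i, rfl⟩
  have hlN : ∀ m, N ≤ m → l m = L := by
    intro m hm
    have := hclos m (hN m hm (by rw [hg]; exact one_dvd _)) 0 hl0
    simpa using this
  refine ⟨L, ?_, ?_⟩
  · rw [← hl0]
    exact lt_of_lt_of_le hc0 (ge_of_tendsto' (hl 0) fun n => hc _)
  · rw [Metric.tendsto_nhds]
    intro ε hε
    have h1 : ∀ᶠ n in (U : Filter ℕ), ∀ j ∈ Finset.range (A + 1), L - ε / 2 < w (n - (N + j)) := by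
      rw [Filter.eventually_all_finset]
      intro j _
      refine (hl (N + j)).eventually_const_lt ?_
      rw [hlN _ (by omega)]; linarith
    have h2 : ∀ᶠ n in (U : Filter ℕ), N + A ≤ n := hU (eventually_ge_atTop (N + A))
    obtain ⟨n, hn1, hn2⟩ := (h1.and h2).exists
    have h3 := aux_lower a ha p hp hp1 A hA w hw (L - ε / 2) (n - (N + A)) (by
      intro m hm1 hm2
      have h4 := hn1 (n - N - m) (by simp; omega)
      have h5 : n - (N + (n - N - m)) = m := by omega
      rw [h5] at h4
      exact h4.le)
    filter_upwards [hup ε hε, eventually_ge_atTop (n - (N + A))] with m hm1 hm2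
    have := h3 m hm2
    rw [Real.dist_eq, abs_lt]
    constructor <;> linarith

lemma aux_finite {r : ℕ} (a : Fin r → ℕ) (ha : ∀ i, 0 < a i) (n : ℕ) :
    Finite {ω : List (Fin r) // (ω.map a).sum ≤ n} := by
  refine Set.Finite.subset (List.finite_length_le (Fin r) n) ?_
  intro ω hω
  have : ω.length ≤ (ω.map a).sum := by
    clear hω
    induction ω with
    | nil => simp
    | cons i t ih => have := ha i; simp; omega
  exact this.trans hω

def auxEquiv {r : ℕ} (a : Fin r → ℕ) (n : ℕ) (hn : ∀ i, a i ≤ n) :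
    {ω : List (Fin r) // (ω.map a).sum ≤ n} ≃
      Option (Σ i : Fin r, {ω : List (Fin r) // (ω.map a).sum ≤ n - a i}) where
  toFun
    | ⟨[], _⟩ => none
    | ⟨i :: t, h⟩ => some ⟨i, t, by simp at h; omega⟩
  invFun
    | none => ⟨[], by simp⟩
    | some ⟨i, t, h⟩ => ⟨i :: t, by have := hn i; simp; omega⟩
  left_inv := by rintro ⟨_ | ⟨i, t⟩, h⟩ <;> rfl
  right_inv := by rintro (_ | ⟨i, t, h⟩) <;> rfl

lemma aux_rec {r : ℕ} (a : Fin r → ℕ) (ha : ∀ i, 0 < a i) (n : ℕ) (hn : ∀ i, a i ≤ n) :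
    Nat.card {ω : List (Fin r) // (ω.map a).sum ≤ n} =
      ∑ i, Nat.card {ω : List (Fin r) // (ω.map a).sum ≤ n - a i} + 1 := by
  have := aux_finite a ha
  rw [Nat.card_congr (auxEquiv a n hn), Finite.card_option, Nat.card_sigma]

/-- in the cyclic case `d i = d ^ (a i)` with `gcd(a_1,…,a_r) = 1`, the
number of words of weight at most `X` is asymptotic to `C · d^{ρ·⌊log_d X⌋}`. -/
theorem stmt_5 (r : ℕ) (hr : 2 ≤ r) (d : ℕ) (hd : 2 ≤ d)
    (a : Fin r → ℕ) (ha : ∀ i, 0 < a i) (hgcd : Finset.univ.gcd a = 1)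
    (ρ : ℝ) (hρ : 0 < ρ) (hsum : ∑ i, ((d ^ a i : ℕ) : ℝ) ^ (-ρ) = 1) :
    ∃ C : ℝ, 0 < C ∧
      Tendsto (fun X : ℝ =>
          (Nat.card {ω : List (Fin r) // ((ω.map fun i => d ^ a i).prod : ℝ) ≤ X} : ℝ) /
            (d : ℝ) ^ (ρ * (⌊Real.logb d X⌋₊ : ℝ)))
        atTop (nhds C) := by
  have hd1 : (1 : ℝ) < d := by exact_mod_cast hd
  have hd0 : (0 : ℝ) < d := by linarith
  set q : ℝ := (d : ℝ) ^ (-ρ) with hq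
  have hq0 : 0 < q := Real.rpow_pos_of_pos hd0 _
  have hq1 : q < 1 := Real.rpow_lt_one_of_one_lt_of_neg hd1 (by linarith)
  have hp1 : ∑ i, q ^ a i = 1 := by
    rw [← hsum]
    refine Finset.sum_congr rfl fun i _ => ?_
    rw [hq]
    push_cast
    rw [← Real.rpow_natCast, ← Real.rpow_natCast, ← Real.rpow_mul hd0.le, ← Real.rpow_mul hd0.le,
      mul_comm]
  set S : ℕ → ℝ := fun n => (Nat.card {ω : List (Fin r) // (ω.map a).sum ≤ n} : ℝ) with hS
  have hr1 : (0 : ℝ) < (r : ℝ) - 1 := by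
    have : (2 : ℝ) ≤ r := by exact_mod_cast hr
    linarith
  set e : ℝ := 1 / ((r : ℝ) - 1) with he
  have he0 : 0 < e := by positivity
  have her : (r : ℝ) * e = e + 1 := by rw [he]; field_simp; ring
  obtain ⟨C, hC, hlim⟩ := aux_conv a ha hgcd (fun i => q ^ a i) (fun i => pow_pos hq0 _) hp1
    (∑ i, a i) (fun i => Finset.single_le_sum (fun _ _ => Nat.zero_le _) (Finset.mem_univ i))
    (fun n => (S n + e) * q ^ n) (by
      intro n hn
      have hn' : ∀ i, a i ≤ n := fun i =>
        (Finset.single_le_sum (fun _ _ => Nat.zero_le _) (Finset.mem_univ i)).trans hn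
      have h1 : S n = ∑ i, S (n - a i) + 1 := by
        simp only [hS]
        exact_mod_cast aux_rec a ha n hn'
      have h2 : S n + e = ∑ i, (S (n - a i) + e) := by
        rw [Finset.sum_add_distrib, h1]
        simp
        linarith
      show (S n + e) * q ^ n = ∑ i, q ^ a i * ((S (n - a i) + e) * q ^ (n - a i))
      rw [h2, Finset.sum_mul]
      refine Finset.sum_congr rfl fun i _ => ?_
      rw [← Nat.sub_add_cancel (hn' i), pow_add, Nat.add_sub_cancel]
      ring)
    (fun n => by
      have : 0 ≤ S n := Nat.cast_nonneg _
      positivity)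
  refine ⟨C, hC, ?_⟩
  have hlim2 : Tendsto (fun n => S n * q ^ n) atTop (nhds C) := by
    have h1 := hlim.sub ((tendsto_pow_atTop_nhds_zero_of_lt_one hq0.le hq1).const_mul e)
    rw [mul_zero, sub_zero] at h1
    refine h1.congr fun n => ?_
    ring
  have hfl : Tendsto (fun X : ℝ => ⌊Real.logb d X⌋₊) atTop atTop :=
    tendsto_nat_floor_atTop.comp (Real.tendsto_logb_atTop hd1)
  refine (hlim2.comp hfl).congr' ?_
  filter_upwards [eventually_ge_atTop 1] with X hX
  have hX0 : 0 < X := by linarith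
  have hlog : 0 ≤ Real.logb d X := Real.logb_nonneg hd1 hX
  simp only [Function.comp, hS]
  rw [div_eq_mul_inv, ← Real.rpow_neg hd0.le, ← neg_mul, Real.rpow_mul hd0.le, Real.rpow_natCast]
  congr 2
  refine Nat.card_congr (Equiv.subtypeEquivRight fun ω => ?_)
  have hprod : (ω.map fun i => d ^ a i).prod = d ^ (ω.map a).sum := by
    induction ω with
    | nil => simp
    | cons i t ih => simp [ih, pow_add]
  rw [Nat.le_floor_iff hlog, Real.le_logb_iff_rpow_le hd1 hX0, Real.rpow_natCast, hprod, Nat.cast_pow]
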